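/- Let Φ be a unital positive linear map on B(H) and let 0 ≤ γ ≤ 1/2. Then for every positive invertible operator A ∈ B(H), |Φ(A^γ)^{-1} Φ(A)| ≥ Φ(A^{1-γ}). -/

import Mathlib

open scoped NNReal

variable {H : Type*} [NormedAddCommGroup H] [InnerProductSpace ℂ H] [CompleteSpace H]

/-- The absolute value `|X| = (X*X)^(1/2)` of a bounded operator `X` on a Hilbert space. -/
noncomputable def opAbs (X : H →L[ℂ] H) : H →L[ℂ] H := CFC.sqrt (star X * X)

/-- `Φ` is a unital positive linear map on `B(H)`: `Φ(I) = I` and `Φ(X) ≥ 0` whenever `X ≥ 0`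
(with respect to the Löwner order). -/
def IsUnitalPositiveMap (Φ : (H →L[ℂ] H) →ₗ[ℂ] (H →L[ℂ] H)) : Prop :=
  Φ 1 = 1 ∧ ∀ X : H →L[ℂ] H, 0 ≤ X → 0 ≤ Φ X

/-- `f : (0,∞) → (0,∞)` is operator convex: for all positive invertible operators `A, B` on `H`
and all `c ∈ [0,1]`, `f(cA + (1-c)B) ≤ c f(A) + (1-c) f(B)` in the Löwner order, where `f(A)` is
given by the continuous functional calculus. -/
def IsOperatorConvexOn (H : Type*) [NormedAddCommGroup H] [InnerProductSpace ℂ H]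
    [CompleteSpace H] (f : ℝ → ℝ) : Prop :=
  ∀ (A B : H →L[ℂ] H), 0 ≤ A → IsUnit A → 0 ≤ B → IsUnit B →
    ∀ c : ℝ, c ∈ Set.Icc (0 : ℝ) 1 →
      cfc f (c • A + (1 - c) • B) ≤ c • cfc f A + (1 - c) • cfc f B

/-- `f : (0,∞) → (0,∞)` is operator concave if `-f` is operator convex. -/
def IsOperatorConcaveOn (H : Type*) [NormedAddCommGroup H] [InnerProductSpace ℂ H]
    [CompleteSpace H] (f : ℝ → ℝ) : Prop :=
  IsOperatorConvexOn H (fun t => -(f t))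

section
variable {A B : Type*} [CStarAlgebra A] [PartialOrder A] [StarOrderedRing A]
  [CStarAlgebra B] [PartialOrder B] [StarOrderedRing B]

open Polynomial in
/-- Bernstein polynomials are nonnegative on elements `0 ≤ a ≤ 1` of a C⋆-algebra. -/
lemma aeval_bernsteinPolynomial_nonneg {a : A} (ha : 0 ≤ a) (ha1 : a ≤ 1) (n k : ℕ) :
    0 ≤ aeval a (bernsteinPolynomial ℝ n k) := by
  have h1 : 0 ≤ 1 - a := sub_nonneg.mpr ha1
  have hcomm : Commute (a ^ k) ((1 - a) ^ (n - k)) :=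
    ((Commute.one_right a).sub_right (Commute.refl a)).pow_pow _ _
  have key : 0 ≤ a ^ k * (1 - a) ^ (n - k) :=
    hcomm.mul_nonneg (CStarAlgebra.pow_nonneg ha k) (CStarAlgebra.pow_nonneg h1 (n - k))
  simpa [bernsteinPolynomial, mul_assoc, ← nsmul_eq_mul] using nsmul_nonneg key (n.choose k)

namespace PositiveLinearMap

open Polynomial in
/-- Up to an error of order `1 / n`, `Φ` satisfies the inequality of
`PositiveLinearMap.map_sq_sub_nonneg`: sum the conjugates of `Φ (bₖ a)` by `k / n - c`, where
`bₖ` are the Bernstein polynomials of degree `n`. -/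
lemma map_sq_sub_add_inv_smul_nonneg (Φ : A →ₚ[ℂ] B) {a : A} (ha : 0 ≤ a) (ha1 : a ≤ 1) {c : B}
    (hc : IsSelfAdjoint c) {n : ℕ} (hn : n ≠ 0) :
    0 ≤ Φ (a ^ 2) - c * Φ a - Φ a * c + c * Φ 1 * c + (n : ℝ)⁻¹ • (Φ a - Φ (a ^ 2)) := by
  set h : ℕ → A := fun k ↦ aeval a (bernsteinPolynomial ℝ n k)
  have e0 : ∑ k ∈ Finset.range (n + 1), Φ (h k) = Φ 1 := by
    simpa [h] using congrArg (fun q ↦ Φ (aeval a q)) (bernsteinPolynomial.sum ℝ n)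
  have e1 : ∑ k ∈ Finset.range (n + 1), (k : ℝ) • Φ (h k) = (n : ℝ) • Φ a := by
    have key := congrArg (fun q ↦ Φ (aeval a q)) (bernsteinPolynomial.sum_smul ℝ n)
    simp only [Nat.cast_smul_eq_nsmul]
    simpa only [map_sum, map_nsmul, aeval_X] using key
  have e2 : ∑ k ∈ Finset.range (n + 1), ((k : ℝ) * (k - 1)) • Φ (h k)
      = ((n : ℝ) * (n - 1)) • Φ (a ^ 2) := by
    have key := congrArg (fun q ↦ Φ (aeval a q)) (bernsteinPolynomial.sum_mul_smul ℝ n)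
    have hcast (m : ℕ) : ((m : ℝ) * (m - 1)) = ((m * (m - 1) : ℕ) : ℝ) := by
      cases m <;> simp
    simp only [hcast, Nat.cast_smul_eq_nsmul]
    simpa only [map_sum, map_nsmul, map_pow, aeval_X] using key
  have hpos : 0 ≤ ∑ k ∈ Finset.range (n + 1),
      ((k : ℝ) • (1 : B) - (n : ℝ) • c) * Φ (h k) * ((k : ℝ) • (1 : B) - (n : ℝ) • c) := by
    refine Finset.sum_nonneg fun k _ ↦ ?_
    have hs : IsSelfAdjoint ((k : ℝ) • (1 : B) - (n : ℝ) • c) :=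
      ((IsSelfAdjoint.all _).smul (.one B)).sub ((IsSelfAdjoint.all _).smul hc)
    exact hs.conjugate_nonneg (Φ.map_nonneg (aeval_bernsteinPolynomial_nonneg ha ha1 n k))
  have hsum : ∑ k ∈ Finset.range (n + 1),
      ((k : ℝ) • (1 : B) - (n : ℝ) • c) * Φ (h k) * ((k : ℝ) • (1 : B) - (n : ℝ) • c)
      = ((n : ℝ) * (n - 1)) • Φ (a ^ 2) + (n : ℝ) • Φ a - (n : ℝ) • (c * ((n : ℝ) • Φ a))
        - (n : ℝ) • (((n : ℝ) • Φ a) * c) + ((n : ℝ) * n) • (c * Φ 1 * c) := by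
    rw [← e0, ← e2]
    nth_rw 1 [← e1]
    simp only [← e1, Finset.mul_sum, Finset.sum_mul, Finset.smul_sum, ← Finset.sum_add_distrib,
      ← Finset.sum_sub_distrib]
    refine Finset.sum_congr rfl fun k _ ↦ ?_
    simp only [sub_mul, mul_sub, smul_mul_assoc, mul_smul_comm, one_mul, mul_one]
    module
  rw [hsum] at hpos
  have hn' : (n : ℝ) ≠ 0 := by exact_mod_cast hn
  have := smul_nonneg (show (0 : ℝ) ≤ ((n : ℝ) * n)⁻¹ by positivity) hpos
  convert this using 1
  simp only [smul_mul_assoc, mul_smul_comm]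
  match_scalars <;> field_simp
  ring

lemma map_sq_sub_nonneg_of_le_one (Φ : A →ₚ[ℂ] B) {a : A} (ha : 0 ≤ a) (ha1 : a ≤ 1) {c : B}
    (hc : IsSelfAdjoint c) :
    0 ≤ Φ (a ^ 2) - c * Φ a - Φ a * c + c * Φ 1 * c := by
  have hlim : Filter.Tendsto (fun n : ℕ ↦ Φ (a ^ 2) - c * Φ a - Φ a * c + c * Φ 1 * c +
      (n : ℝ)⁻¹ • (Φ a - Φ (a ^ 2))) Filter.atTop
      (nhds (Φ (a ^ 2) - c * Φ a - Φ a * c + c * Φ 1 * c)) := by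
    simpa using tendsto_const_nhds.add
      ((tendsto_inv_atTop_nhds_zero_nat (𝕜 := ℝ)).smul_const (Φ a - Φ (a ^ 2)))
  refine ge_of_tendsto hlim ?_
  filter_upwards [Filter.eventually_ne_atTop 0] with n hn
  exact Φ.map_sq_sub_add_inv_smul_nonneg ha ha1 hc hn

/-- A positive map is `2`-positive on the commutative subalgebra generated by `a ≥ 0`; this is the
resulting quadratic inequality at the vector `(a, -c)`. -/
lemma map_sq_sub_nonneg (Φ : A →ₚ[ℂ] B) {a : A} (ha : 0 ≤ a) {c : B} (hc : IsSelfAdjoint c) :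
    0 ≤ Φ (a ^ 2) - c * Φ a - Φ a * c + c * Φ 1 * c := by
  set r : ℝ := ‖a‖ + 1
  have hr : 0 < r := by positivity
  have h1 : r⁻¹ • a ≤ 1 := by
    have h2 : a ≤ r • 1 := by
      refine (IsSelfAdjoint.of_nonneg ha).le_algebraMap_norm_self.trans ?_
      rw [Algebra.algebraMap_eq_smul_one]
      exact smul_le_smul_of_nonneg_right (by simp [r]) zero_le_one
    simpa [smul_smul, hr.ne'] using smul_le_smul_of_nonneg_left h2 (inv_nonneg.mpr hr.le)
  have key := Φ.map_sq_sub_nonneg_of_le_one (smul_nonneg (inv_nonneg.mpr hr.le) ha) h1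
    ((IsSelfAdjoint.all r⁻¹).smul hc)
  convert smul_nonneg (sq_nonneg r) key using 1
  simp only [smul_pow, map_smul_of_tower, smul_mul_assoc, mul_smul_comm]
  match_scalars <;> field_simp

/-- **Kadison's inequality** for unital positive maps, for nonnegative elements. -/
lemma sq_map_le_map_sq (Φ : A →ₚ[ℂ] B) (h1 : Φ 1 = 1) {a : A} (ha : 0 ≤ a) :
    Φ a ^ 2 ≤ Φ (a ^ 2) := by
  have key := Φ.map_sq_sub_nonneg ha (IsSelfAdjoint.of_nonneg (Φ.map_nonneg ha))
  rw [h1] at key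
  rw [← sub_nonneg]
  convert key using 1
  noncomm_ring

lemma map_isStrictlyPositive (Φ : A →ₚ[ℂ] B) (h1 : Φ 1 = 1) {a : A} (ha : IsStrictlyPositive a) :
    IsStrictlyPositive (Φ a) := by
  rcases subsingleton_or_nontrivial A with hA | hA
  · have : Subsingleton B := subsingleton_of_zero_eq_one <| by
      rw [← h1, Subsingleton.elim (1 : A) 0, map_zero]
    exact ⟨(Subsingleton.elim _ _).le, isUnit_of_subsingleton _⟩
  obtain ⟨r, hr, hra⟩ := (CFC.exists_pos_algebraMap_le_iff (A := A) ha.isSelfAdjoint).mpr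
    fun x hx ↦ ha.spectrum_pos hx
  have hle : r • (1 : B) ≤ Φ a := by
    rw [← h1, ← map_smul_of_tower, ← Algebra.algebraMap_eq_smul_one]
    exact Φ.monotone' hra
  exact (IsStrictlyPositive.smul hr isStrictlyPositive_one).of_le hle

/-- **Choi's inequality** `(Φ a)⁻¹ ≤ Φ a⁻¹` for unital positive maps. -/
lemma ringInverse_map_le_map_ringInverse (Φ : A →ₚ[ℂ] B) (h1 : Φ 1 = 1) {a : A}
    (ha : IsStrictlyPositive a) : Ring.inverse (Φ a) ≤ Φ (Ring.inverse a) := by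
  have hΦa : IsStrictlyPositive (Φ a) := Φ.map_isStrictlyPositive h1 ha
  set s := CFC.sqrt a
  have hs : IsSelfAdjoint s := .of_nonneg (CFC.sqrt_nonneg a)
  let Ψ : A →ₚ[ℂ] B := Φ.comp
    (.mk₀ (LinearMap.mulLeftRight ℂ (s, s)) fun x hx ↦ by simpa using hs.conjugate_nonneg hx)
  have hΨ (x : A) : Ψ x = Φ (s * x * s) := rfl
  have e0 : Ψ 1 = Φ a := by rw [hΨ, mul_one, CFC.sqrt_mul_sqrt_self a ha.nonneg]
  have hsr : s = a ^ (1 / 2 : ℝ) := CFC.sqrt_eq_rpow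
  have ir : Ring.inverse a = a ^ (-1 : ℝ) := CFC.inverse_eq_rpow_neg_one ha
  have e1 : Ψ (Ring.inverse a) = 1 := by
    rw [hΨ, hsr, ir, ← CFC.rpow_add ha.isUnit, ← CFC.rpow_add ha.isUnit]
    norm_num [CFC.rpow_zero a ha.nonneg, h1]
  have e2 : Ψ (Ring.inverse a ^ 2) = Φ (Ring.inverse a) := by
    rw [hΨ, hsr, ir, sq, ← CFC.rpow_add ha.isUnit, ← CFC.rpow_add ha.isUnit,
      ← CFC.rpow_add ha.isUnit]
    norm_num
  have key := Ψ.map_sq_sub_nonneg ha.ringInverse.nonneg hΦa.ringInverse.isSelfAdjoint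
  rw [e0, e1, e2, Ring.inverse_mul_cancel _ hΦa.isUnit] at key
  simpa using key

end PositiveLinearMap

open Set Real in
lemma cfcₙ_rpowIntegrand₀₁_eq_sub {p t : ℝ} (hp : p ∈ Ioo 0 1) (ht : 0 < t) {a : A} (ha : 0 ≤ a) :
    cfcₙ (rpowIntegrand₀₁ p t) a =
      t ^ (p - 1) • 1 - t ^ p • Ring.inverse (t • 1 + a) := by
  have hspec : ∀ r ∈ spectrum ℝ a, t + r ≠ 0 := fun r hr ↦
    (add_pos_of_pos_of_nonneg ht (spectrum_nonneg_of_nonneg ha hr)).ne'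
  have hcont : ContinuousOn (fun z : ℝ ↦ (t + z)⁻¹) (spectrum ℝ a) :=
    ContinuousOn.inv₀ (by fun_prop) hspec
  have hfun : rpowIntegrand₀₁ p t = fun z ↦ t ^ (p - 1) - t ^ p * (t + z)⁻¹ :=
    rpowIntegrand₀₁_eq_sub hp.2.ne ht
  have hcont' : ContinuousOn (rpowIntegrand₀₁ p t) (quasispectrum ℝ a) :=
    (continuousOn_rpowIntegrand₀₁_Ici hp ht).mono
      fun r hr ↦ quasispectrum_nonneg_of_nonneg a ha r hr
  have hcont_mul : ContinuousOn (fun z : ℝ ↦ t ^ p * (t + z)⁻¹) (spectrum ℝ a) :=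
    hcont.const_mul _
  have hadd : cfc (fun z : ℝ ↦ t + z) a = t • 1 + a := by
    rw [cfc_const_add t (fun z ↦ z) a, cfc_id' ℝ a, Algebra.algebraMap_eq_smul_one]
  rw [cfcₙ_eq_cfc hcont' rpowIntegrand₀₁_zero_right, hfun,
    cfc_sub (fun _ ↦ t ^ (p - 1)) (fun z ↦ t ^ p * (t + z)⁻¹) a continuousOn_const hcont_mul,
    cfc_const _ a, cfc_const_mul _ _ a hcont, cfc_inv (fun z ↦ t + z) a hspec, hadd,
    Algebra.algebraMap_eq_smul_one]

namespace PositiveLinearMap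

open MeasureTheory Set Real in
/-- Operator Jensen inequality `Φ (a ^ p) ≤ Φ a ^ p` for unital positive maps and `p ∈ [0, 1]`. -/
lemma map_rpow_le_rpow_map (Φ : A →ₚ[ℂ] A) (h1 : Φ 1 = 1) {a : A} (ha : 0 ≤ a) {p : ℝ}
    (hp : p ∈ Icc 0 1) : Φ (a ^ p) ≤ Φ a ^ p := by
  have hΦa : 0 ≤ Φ a := Φ.map_nonneg ha
  rcases hp.1.eq_or_lt with rfl | hp0
  · rw [CFC.rpow_zero a, CFC.rpow_zero (Φ a), h1]
  rcases hp.2.eq_or_lt with rfl | hp1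
  · rw [CFC.rpow_one a, CFC.rpow_one (Φ a)]
  lift p to ℝ≥0 using hp.1
  obtain ⟨μ, hμ⟩ := CFC.exists_measure_nnrpow_eq_integral_cfcₙ_rpowIntegrand₀₁ A
    (p := p) ⟨mod_cast hp0, mod_cast hp1⟩
  rw [← CFC.nnrpow_eq_rpow (mod_cast hp0), ← CFC.nnrpow_eq_rpow (mod_cast hp0), (hμ a ha).2,
    (hμ _ hΦa).2]
  let L : A →L[ℂ] A := ⟨Φ.toLinearMap, map_continuous Φ⟩
  change L _ ≤ _
  rw [← L.integral_comp_comm (hμ a ha).1]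
  refine integral_mono_ae (L.integrable_comp (hμ a ha).1) (hμ _ hΦa).1 ?_
  filter_upwards [ae_restrict_mem measurableSet_Ioi] with t ht
  change Φ _ ≤ _
  have ht' : 0 < t := ht
  rw [cfcₙ_rpowIntegrand₀₁_eq_sub ⟨hp0, hp1⟩ ht ha, cfcₙ_rpowIntegrand₀₁_eq_sub ⟨hp0, hp1⟩ ht hΦa]
  have hpos : IsStrictlyPositive (t • 1 + a) :=
    (IsStrictlyPositive.smul ht' isStrictlyPositive_one).add_nonneg ha
  have key := Φ.ringInverse_map_le_map_ringInverse h1 hpos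
  simp only [map_add, map_sub, map_smul_of_tower, h1] at key ⊢
  gcongr

/-- If `Φ` is a unital positive map and `0 ≤ γ ≤ 1/2`, then
`Φ (a ^ (1 - γ)) ≤ |(Φ (a ^ γ))⁻¹ * Φ a|`. -/
lemma map_rpow_one_sub_le_sqrt (Φ : A →ₚ[ℂ] A) (h1 : Φ 1 = 1) {a : A} (ha : IsStrictlyPositive a)
    {γ : ℝ} (hγ0 : 0 ≤ γ) (hγ1 : γ ≤ 1 / 2) :
    Φ (a ^ (1 - γ)) ≤ CFC.sqrt (star (Ring.inverse (Φ (a ^ γ)) * Φ a) *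
      (Ring.inverse (Φ (a ^ γ)) * Φ a)) := by
  set X := Φ (a ^ γ)
  set Y := Φ a
  have hX : IsStrictlyPositive X := Φ.map_isStrictlyPositive h1 (ha.rpow a γ)
  have hY : IsStrictlyPositive Y := Φ.map_isStrictlyPositive h1 ha
  have hXY : X ^ 2 ≤ Y ^ (2 * γ) := calc
    X ^ 2 ≤ Φ ((a ^ γ) ^ 2) := Φ.sq_map_le_map_sq h1 CFC.rpow_nonneg
    _ = Φ (a ^ (2 * γ)) := by rw [sq, ← CFC.rpow_add ha.isUnit, two_mul]
    _ ≤ Y ^ (2 * γ) := Φ.map_rpow_le_rpow_map h1 ha.nonneg ⟨by linarith, by linarith⟩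
  have hX2 : IsStrictlyPositive (X ^ 2) :=
    (hX.isUnit.pow 2).isStrictlyPositive (CStarAlgebra.pow_nonneg hX.nonneg 2)
  have hYinv : Ring.inverse (Y ^ (2 * γ)) = Y ^ (-(2 * γ)) :=
    Ring.inverse_unit (hY.isUnit.unit.cfcRpow (2 * γ) hY.nonneg)
  have hinv : Y ^ (-(2 * γ)) ≤ Ring.inverse X ^ 2 := by
    rw [← hYinv, Ring.inverse_pow]
    exact CStarAlgebra.ringInverse_le_ringInverse hXY hX2
  have hsq : Y ^ (1 - γ) * Y ^ (1 - γ) ≤ star (Ring.inverse X * Y) * (Ring.inverse X * Y) := calc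
    Y ^ (1 - γ) * Y ^ (1 - γ) = Y ^ (1 : ℝ) * Y ^ (-(2 * γ)) * Y ^ (1 : ℝ) := by
      simp only [← CFC.rpow_add hY.isUnit]
      ring_nf
    _ = Y * Y ^ (-(2 * γ)) * Y := by rw [CFC.rpow_one Y hY.nonneg]
    _ ≤ Y * Ring.inverse X ^ 2 * Y := hY.isSelfAdjoint.conjugate_le_conjugate hinv
    _ = star (Ring.inverse X * Y) * (Ring.inverse X * Y) := by
      rw [star_mul, hY.isSelfAdjoint.star_eq, hX.ringInverse.isSelfAdjoint.star_eq]
      noncomm_ring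
  calc Φ (a ^ (1 - γ)) ≤ Y ^ (1 - γ) :=
        Φ.map_rpow_le_rpow_map h1 ha.nonneg ⟨by linarith, by linarith⟩
    _ = CFC.sqrt (Y ^ (1 - γ) * Y ^ (1 - γ)) := (CFC.sqrt_mul_self _ CFC.rpow_nonneg).symm
    _ ≤ _ := CFC.sqrt_le_sqrt _ _ hsq

end PositiveLinearMap

end

/-- **Corollary 2.7, second inequality.** `|Φ(A^γ)⁻¹ Φ(A)| ≥ Φ(A^(1-γ))` for each unital
positive linear map `Φ`, each positive invertible operator `A`, and each `0 ≤ γ ≤ 1/2`. -/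
theorem abs_power_ge_choi_davis
    (Φ : (H →L[ℂ] H) →ₗ[ℂ] (H →L[ℂ] H)) (hΦ : IsUnitalPositiveMap Φ)
    (γ : ℝ) (hγ0 : 0 ≤ γ) (hγ1 : γ ≤ 1 / 2)
    (A : H →L[ℂ] H) (hA : 0 ≤ A) (hAu : IsUnit A) :
    Φ (CFC.rpow A (1 - γ)) ≤ opAbs (Ring.inverse (Φ (CFC.rpow A γ)) * Φ A) := by
  exact (PositiveLinearMap.mk₀ Φ hΦ.2).map_rpow_one_sub_le_sqrt hΦ.1
    (hAu.isStrictlyPositive hA) hγ0 hγ1
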